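/- There is an absolute constant C such that for every Schwartz function g : ℝ⁴ → ℂ, every unit vector ω ∈ ℝ⁴, and every η ∈ (0,1], the mass of g on the angular sector of aperture η about ω obeys the angular concentration estimate ( ∫_{{ξ≠0 : ∠(ξ,ω) ≤ η}} |g(ξ)|² dξ )^{1/2} ≤ C η ( ‖g‖_{L²(ℝ⁴)} + Σ_{1≤i<j≤4} ‖Ω_{ij} g‖_{L²(ℝ⁴)} ). -/

import Mathlib

open MeasureTheory
open scoped ENNReal BigOperators

noncomputable section

/-- Four-dimensional Euclidean space. -/
abbrev Sp : Type := EuclideanSpace ℝ (Fin 4)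

/-- The angular momentum (rotation) vector fields `Ω_{ij}g(x) = x_i ∂_j g − x_j ∂_i g`. -/
def Omega (i j : Fin 4) (g : Sp → ℂ) (x : Sp) : ℂ :=
  (x i : ℂ) * fderiv ℝ g x (EuclideanSpace.single j (1:ℝ))
    - (x j : ℂ) * fderiv ℝ g x (EuclideanSpace.single i (1:ℝ))

open scoped LineDeriv InnerProductSpace

/-- The component of `x` along `ω`. -/
def axial (ω x : Sp) : ℝ := ⟪ω, x⟫_ℝ

/-- For a unit vector `ω`, the squared distance of `x` to the line `ℝω`, regularized by `ε`. -/
def regDist (ε : ℝ) (ω x : Sp) : ℝ := ‖x‖ ^ 2 - axial ω x ^ 2 + ε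

/-- The components of a vector field tangent to the spheres about the origin and pointing towards
the axis `ℝω`. -/
def polarField (ε : ℝ) (ω : Sp) (k : Fin 4) (x : Sp) : ℝ :=
  axial ω x * (‖x‖ ^ 2 * ω k - axial ω x * x k) * (regDist ε ω x)⁻¹

/-- The sum of the moduli of the angular derivatives of `g`. -/
def angularSum (g : Sp → ℂ) (x : Sp) : ℝ :=
  ∑ p : Fin 4 × Fin 4 with p.1 < p.2, ‖Omega p.1 p.2 g x‖

lemma axial_eq_sum (ω x : Sp) : axial ω x = ∑ k, ω k * x k := by
  simp [axial, PiLp.inner_apply, mul_comm]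

lemma axial_sq_le {ω : Sp} (hω : ‖ω‖ = 1) (x : Sp) : axial ω x ^ 2 ≤ ‖x‖ ^ 2 := by
  have h := abs_real_inner_le_norm ω x
  rw [hω, one_mul] at h
  exact sq_le_sq' (abs_le.1 h).1 (abs_le.1 h).2

lemma regDist_pos {ε : ℝ} (hε : 0 < ε) {ω : Sp} (hω : ‖ω‖ = 1) (x : Sp) :
    0 < regDist ε ω x := by
  have := axial_sq_le hω x
  unfold regDist
  linarith

lemma axial_hasTemperateGrowth (ω : Sp) : (axial ω).HasTemperateGrowth :=
  (innerSL ℝ ω).hasTemperateGrowth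

lemma coord_hasTemperateGrowth (k : Fin 4) : (fun x : Sp => x k).HasTemperateGrowth :=
  (EuclideanSpace.proj (𝕜 := ℝ) k).hasTemperateGrowth

lemma regDist_inv_hasTemperateGrowth {ε : ℝ} (hε : 0 < ε) {ω : Sp} (hω : ‖ω‖ = 1) :
    (fun x => (regDist ε ω x)⁻¹).HasTemperateGrowth := by
  let L : Sp →L[ℝ] Sp :=
    (√ε)⁻¹ • (ContinuousLinearMap.id ℝ Sp - (innerSL ℝ ω).smulRight ω)
  have hL (x : Sp) : 1 + ‖L x‖ ^ 2 = ε⁻¹ * regDist ε ω x := by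
    have h1 : L x = (√ε)⁻¹ • (x - axial ω x • ω) := by simp [L, axial]
    rw [h1, norm_smul, mul_pow, norm_sub_sq_real, inner_smul_right, norm_smul, hω,
      real_inner_comm, Real.norm_eq_abs, Real.norm_eq_abs, mul_one, sq_abs, sq_abs, inv_pow,
      Real.sq_sqrt hε.le]
    change _ + _ * (‖x‖ ^ 2 - 2 * (axial ω x * axial ω x) + _) = _
    unfold regDist
    field_simp
    ring
  have h := (Function.hasTemperateGrowth_one_add_norm_sq_rpow Sp (-1)).comp L.hasTemperateGrowth
  have h2 := (Function.HasTemperateGrowth.const (E := Sp) ε⁻¹).mul h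
  convert! h2 using 1
  funext x
  simp only [Pi.mul_apply, Function.comp_apply, hL, Real.rpow_neg_one]
  field_simp

lemma polarField_hasTemperateGrowth {ε : ℝ} (hε : 0 < ε) {ω : Sp} (hω : ‖ω‖ = 1) (k : Fin 4) :
    (polarField ε ω k).HasTemperateGrowth := by
  have h1 := axial_hasTemperateGrowth ω
  have h2 := coord_hasTemperateGrowth k
  have h3 := Function.hasTemperateGrowth_norm_sq (H := Sp)
  have h4 := Function.HasTemperateGrowth.const (E := Sp) (ω k)
  exact (h1.mul ((h3.mul h4).sub (h1.mul h2))).mul (regDist_inv_hasTemperateGrowth hε hω)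

lemma fderiv_polarField {ε : ℝ} (hε : 0 < ε) {ω : Sp} (hω : ‖ω‖ = 1) (k : Fin 4) (x : Sp) :
    fderiv ℝ (polarField ε ω k) x (EuclideanSpace.single k 1) =
      (‖x‖ ^ 2 * ω k ^ 2 - axial ω x ^ 2) * (regDist ε ω x)⁻¹
        - axial ω x * (‖x‖ ^ 2 * ω k - axial ω x * x k) *
          (2 * x k - 2 * axial ω x * ω k) * ((regDist ε ω x)⁻¹) ^ 2 := by
  have hd : DifferentiableAt ℝ (polarField ε ω k) x :=
    (polarField_hasTemperateGrowth hε hω k).1.differentiable (by simp) x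
  rw [← hd.lineDeriv_eq_fderiv]
  apply HasLineDerivAt.lineDeriv
  set e : Sp := EuclideanSpace.single k 1 with he
  have hs : HasDerivAt (fun t : ℝ => axial ω (x + t • e)) (ω k) 0 := by
    have : ∀ t : ℝ, axial ω (x + t • e) = axial ω x + t * ω k := fun t => by
      simp [axial, inner_add_right, inner_smul_right, he, EuclideanSpace.inner_single_right]
    simp only [this]
    simpa using ((hasDerivAt_id (0 : ℝ)).mul_const (ω k)).const_add (axial ω x)
  have hp : HasDerivAt (fun t : ℝ => ‖x + t • e‖ ^ 2) (2 * x k) 0 := by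
    have : ∀ t : ℝ, ‖x + t • e‖ ^ 2 = ‖x‖ ^ 2 + t * (2 * x k) + t ^ 2 := fun t => by
      rw [norm_add_sq_real, norm_smul, inner_smul_right]
      simp [he, EuclideanSpace.inner_single_right]
      ring
    simp only [this]
    simpa using (((hasDerivAt_id (0 : ℝ)).mul_const (2 * x k)).const_add (‖x‖ ^ 2)).fun_add
      ((hasDerivAt_id (0 : ℝ)).fun_pow 2)
  have hx : HasDerivAt (fun t : ℝ => (x + t • e) k) 1 0 := by
    simpa [he] using (hasDerivAt_id (0 : ℝ)).const_add (x k)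
  have hD : HasDerivAt (fun t : ℝ => regDist ε ω (x + t • e))
      (2 * x k - 2 * axial ω x * ω k) 0 := by
    have := (hp.sub (hs.pow 2)).add_const ε
    simpa [regDist] using! this
  have hne : regDist ε ω (x + (0 : ℝ) • e) ≠ 0 := (regDist_pos hε hω _).ne'
  have := (hs.mul ((hp.mul_const (ω k)).sub (hs.mul hx))).mul (hD.inv hne)
  refine HasDerivAt.congr_deriv (f := fun t : ℝ => polarField ε ω k (x + t • e)) this ?_
  simp only [zero_smul, add_zero, Pi.mul_apply, Pi.sub_apply, Pi.inv_apply]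
  field_simp
  ring

lemma divergence_polarField_le {ε : ℝ} (hε : 0 < ε) {ω : Sp} (hω : ‖ω‖ = 1) (x : Sp) :
    ∑ k, fderiv ℝ (polarField ε ω k) x (EuclideanSpace.single k 1) ≤
      1 - axial ω x ^ 2 * (regDist ε ω x)⁻¹ := by
  simp only [fderiv_polarField hε hω]
  have h1 : ∑ k, ω k ^ 2 = 1 := by rw [← EuclideanSpace.real_norm_sq_eq, hω, one_pow]
  have h2 := EuclideanSpace.real_norm_sq_eq x
  have h3 := axial_eq_sum ω x
  have hD := regDist_pos hε hω x
  have hs := axial_sq_le hω x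
  set s := axial ω x
  set p := ‖x‖ ^ 2
  have hDe : regDist ε ω x = p - s ^ 2 + ε := rfl
  set D := regDist ε ω x
  have key : ∑ k, ((p * ω k ^ 2 - s ^ 2) * D⁻¹
        - s * (p * ω k - s * x k) * (2 * x k - 2 * s * ω k) * D⁻¹ ^ 2) =
      (p - 4 * s ^ 2) * D⁻¹ + 2 * s ^ 2 * (p - s ^ 2) * D⁻¹ ^ 2 := by
    simp only [Fin.sum_univ_four] at h1 h2 h3 ⊢
    linear_combination (p * D⁻¹ + 2 * s ^ 2 * p * D⁻¹ ^ 2) * h1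
      + (-2 * s ^ 2 * D⁻¹ ^ 2) * h2 + (2 * s * (p + s ^ 2) * D⁻¹ ^ 2) * h3
  rw [key]
  have h5 : 1 - s ^ 2 * D⁻¹ - ((p - 4 * s ^ 2) * D⁻¹ + 2 * s ^ 2 * (p - s ^ 2) * D⁻¹ ^ 2)
      = ε * D⁻¹ + 2 * s ^ 2 * ε * D⁻¹ ^ 2 := by
    field_simp
    rw [hDe]
    ring
  have : 0 ≤ ε * D⁻¹ + 2 * s ^ 2 * ε * D⁻¹ ^ 2 := by positivity
  linarith

lemma sq_cross_le {ω : Sp} (hω : ‖ω‖ = 1) (x : Sp) (i j : Fin 4) :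
    (x i * ω j - x j * ω i) ^ 2 ≤ 2 * (‖x‖ ^ 2 - axial ω x ^ 2) := by
  have h1 : ∑ k, ω k ^ 2 = 1 := by rw [← EuclideanSpace.real_norm_sq_eq, hω, one_pow]
  have h2 := EuclideanSpace.real_norm_sq_eq x
  have h3 := axial_eq_sum ω x
  have : ∑ i, ∑ j, (x i * ω j - x j * ω i) ^ 2 = 2 * (‖x‖ ^ 2 - axial ω x ^ 2) := by
    have h4 : ‖x‖ ^ 2 = (∑ k, x k ^ 2) * ∑ k, ω k ^ 2 := by rw [h1, h2, mul_one]
    rw [h4, h3]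
    simp only [Fin.sum_univ_four]
    ring
  rw [← this]
  exact (Finset.single_le_sum (f := fun j => (x i * ω j - x j * ω i) ^ 2)
      (fun _ _ => sq_nonneg _) (Finset.mem_univ j)).trans
    (Finset.single_le_sum (f := fun i => ∑ j, (x i * ω j - x j * ω i) ^ 2)
      (fun _ _ => Finset.sum_nonneg fun _ _ => sq_nonneg _) (Finset.mem_univ i))

lemma angularSum_nonneg (g : Sp → ℂ) (x : Sp) : 0 ≤ angularSum g x :=
  Finset.sum_nonneg fun _ _ => norm_nonneg _

lemma norm_polar_derivative_le {ω : Sp} (hω : ‖ω‖ = 1) (g : Sp → ℂ) (x : Sp) :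
    ‖∑ k, (‖x‖ ^ 2 * ω k - axial ω x * x k) • fderiv ℝ g x (EuclideanSpace.single k 1)‖ ≤
      √(2 * (‖x‖ ^ 2 - axial ω x ^ 2)) * angularSum g x := by
  have key : ∑ k, (‖x‖ ^ 2 * ω k - axial ω x * x k) • fderiv ℝ g x (EuclideanSpace.single k 1) =
      ∑ p : Fin 4 × Fin 4 with p.1 < p.2,
        (x p.1 * ω p.2 - x p.2 * ω p.1) • Omega p.1 p.2 g x := by
    rw [EuclideanSpace.real_norm_sq_eq x, axial_eq_sum, Finset.sum_filter, Fintype.sum_prod_type]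
    simp only [Fin.sum_univ_four, Omega, Complex.real_smul]
    simp
    ring
  rw [key, angularSum, Finset.mul_sum]
  refine (norm_sum_le _ _).trans (Finset.sum_le_sum fun p _ => ?_)
  rw [norm_smul]
  gcongr
  exact Real.abs_le_sqrt (sq_cross_le hω x p.1 p.2)

lemma two_mul_inner_polarField_le {ε : ℝ} (hε : 0 < ε) {ω : Sp} (hω : ‖ω‖ = 1) (g : Sp → ℂ)
    (x : Sp) :
    2 * ∑ k, polarField ε ω k x * ⟪g x, fderiv ℝ g x (EuclideanSpace.single k 1)⟫_ℝ ≤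
      1 / 2 * (axial ω x ^ 2 * (regDist ε ω x)⁻¹ * ‖g x‖ ^ 2) + 4 * angularSum g x ^ 2 := by
  have hD := regDist_pos hε hω x
  have hM := angularSum_nonneg g x
  set T := ∑ k, (‖x‖ ^ 2 * ω k - axial ω x * x k) • fderiv ℝ g x (EuclideanSpace.single k 1)
    with hT
  have hsum : ∑ k, polarField ε ω k x * ⟪g x, fderiv ℝ g x (EuclideanSpace.single k 1)⟫_ℝ =
      axial ω x * (regDist ε ω x)⁻¹ * ⟪g x, T⟫_ℝ := by
    rw [hT, inner_sum, Finset.mul_sum]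
    refine Finset.sum_congr rfl fun k _ => ?_
    rw [inner_smul_right, polarField]
    ring
  have hT1 : ‖T‖ ≤ √(2 * regDist ε ω x) * angularSum g x := by
    refine (norm_polar_derivative_le hω g x).trans ?_
    gcongr
    unfold regDist
    linarith
  have hT2 : ‖T‖ ^ 2 ≤ 2 * regDist ε ω x * angularSum g x ^ 2 := by
    calc ‖T‖ ^ 2 ≤ (√(2 * regDist ε ω x) * angularSum g x) ^ 2 := by gcongr
      _ = _ := by rw [mul_pow, Real.sq_sqrt (by positivity)]
  rw [hsum]
  set s := axial ω x
  set D := regDist ε ω x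
  have h1 : 2 * (s * D⁻¹ * ⟪g x, T⟫_ℝ) ≤ 2 * (|s| * D⁻¹ * (‖g x‖ * ‖T‖)) := by
    refine mul_le_mul_of_nonneg_left ((le_abs_self _).trans ?_) zero_le_two
    rw [abs_mul, abs_mul, abs_of_pos (inv_pos.2 hD)]
    gcongr
    exact abs_real_inner_le_norm _ _
  have h2 : 2 * (|s| * D⁻¹ * (‖g x‖ * ‖T‖)) ≤
      1 / 2 * (s ^ 2 * D⁻¹ * ‖g x‖ ^ 2) + 2 * D⁻¹ * ‖T‖ ^ 2 := by
    have : 0 ≤ D⁻¹ * (|s| * ‖g x‖ - 2 * ‖T‖) ^ 2 := by positivity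
    rw [← sq_abs s]
    linarith
  have h3 : 2 * D⁻¹ * ‖T‖ ^ 2 ≤ 4 * angularSum g x ^ 2 := by
    calc 2 * D⁻¹ * ‖T‖ ^ 2 ≤ 2 * D⁻¹ * (2 * D * angularSum g x ^ 2) := by gcongr
      _ = _ := by field_simp; ring
  linarith

lemma integrable_temperate_mul_inner {a : Sp → ℝ} (ha : a.HasTemperateGrowth)
    (f h : SchwartzMap Sp ℂ) : Integrable (fun x => a x * ⟪f x, h x⟫_ℝ) := by
  have := (SchwartzMap.pairing (innerSL ℝ)
    (SchwartzMap.smulLeftCLM ℂ a f) h).integrable (μ := volume)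
  refine this.congr (ae_of_all _ fun x => ?_)
  change ⟪SchwartzMap.smulLeftCLM ℂ a f x, h x⟫_ℝ = _
  rw [SchwartzMap.smulLeftCLM_apply_apply ha, real_inner_smul_left]

lemma integral_by_parts_temperate {a : Sp → ℝ} (ha : a.HasTemperateGrowth)
    (g : SchwartzMap Sp ℂ) (v : Sp) :
    Integrable (fun x => fderiv ℝ a x v * ‖g x‖ ^ 2) ∧
    ∫ x, 2 * (a x * ⟪g x, fderiv ℝ g x v⟫_ℝ) = -∫ x, fderiv ℝ a x v * ‖g x‖ ^ 2 := by
  set f := SchwartzMap.smulLeftCLM ℂ a g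
  have hfx (x : Sp) : f x = a x • g x := SchwartzMap.smulLeftCLM_apply_apply ha g x
  have hd (x : Sp) : ∂_{v} f x = a x • ∂_{v} g x + fderiv ℝ a x v • g x := by
    have h1 : ⇑f = fun x => a x • g x := funext hfx
    have h2 : HasFDerivAt a (fderiv ℝ a x) x :=
      (ha.1.differentiable (by simp) x).hasFDerivAt
    rw [SchwartzMap.lineDerivOp_apply_eq_fderiv, h1, (h2.fun_smul (g.hasFDerivAt x)).fderiv]
    simp [SchwartzMap.lineDerivOp_apply_eq_fderiv]
  have hibp : ∫ x, ⟪f x, ∂_{v} g x⟫_ℝ = -∫ x, ⟪∂_{v} f x, g x⟫_ℝ :=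
    SchwartzMap.integral_bilinear_lineDerivOp_right_eq_neg_left f g (innerSL ℝ) v
  have i1 := integrable_temperate_mul_inner ha g (∂_{v} g)
  have i2 : Integrable (fun x => ⟪∂_{v} f x, g x⟫_ℝ) :=
    (SchwartzMap.pairing (innerSL ℝ) (∂_{v} f) g).integrable
  have e2 (x : Sp) : ⟪∂_{v} f x, g x⟫_ℝ =
      a x * ⟪g x, ∂_{v} g x⟫_ℝ + fderiv ℝ a x v * ‖g x‖ ^ 2 := by
    rw [hd, inner_add_left, inner_smul_left, inner_smul_left, real_inner_comm,
      real_inner_self_eq_norm_sq]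
    simp
  have i3 : Integrable (fun x => fderiv ℝ a x v * ‖g x‖ ^ 2) := by
    refine (i2.sub i1).congr (ae_of_all _ fun x => ?_)
    simp only [Pi.sub_apply, e2]
    ring
  refine ⟨i3, ?_⟩
  simp only [e2, hfx, real_inner_smul_left] at hibp
  rw [integral_add i1 i3] at hibp
  rw [integral_const_mul]
  simp only [SchwartzMap.lineDerivOp_apply_eq_fderiv] at hibp
  linarith

lemma memLp_Omega (g : SchwartzMap Sp ℂ) (i j : Fin 4) : MemLp (Omega i j g) 2 volume := by
  have h := (SchwartzMap.smulLeftCLM ℂ (fun x : Sp => x i)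
      (∂_{(EuclideanSpace.single j 1 : Sp)} g) -
    SchwartzMap.smulLeftCLM ℂ (fun x : Sp => x j)
      (∂_{(EuclideanSpace.single i 1 : Sp)} g)).memLp 2
  convert! h using 1
  funext x
  simp [Omega, SchwartzMap.smulLeftCLM_apply_apply (coord_hasTemperateGrowth _),
    SchwartzMap.lineDerivOp_apply_eq_fderiv]

lemma memLp_angularSum (g : SchwartzMap Sp ℂ) : MemLp (angularSum g) 2 volume :=
  memLp_finsetSum _ fun p _ => (memLp_Omega g p.1 p.2).norm

/-- A Hardy inequality for the angular derivatives, away from the axis `ℝω`. -/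
lemma integral_axial_sq_le {ε : ℝ} (hε : 0 < ε) {ω : Sp} (hω : ‖ω‖ = 1) (g : SchwartzMap Sp ℂ) :
    Integrable (fun x => axial ω x ^ 2 * (regDist ε ω x)⁻¹ * ‖g x‖ ^ 2) ∧
    ∫ x, axial ω x ^ 2 * (regDist ε ω x)⁻¹ * ‖g x‖ ^ 2 ≤
      2 * (∫ x, ‖g x‖ ^ 2) + 8 * ∫ x, angularSum g x ^ 2 := by
  have iA : Integrable (fun x => axial ω x ^ 2 * (regDist ε ω x)⁻¹ * ‖g x‖ ^ 2) := by
    simpa only [real_inner_self_eq_norm_sq] using! integrable_temperate_mul_inner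
      (((axial_hasTemperateGrowth ω).pow 2).mul (regDist_inv_hasTemperateGrowth hε hω)) g g
  have iG : Integrable (fun x => ‖g x‖ ^ 2) := (g.memLp 2).integrable_norm_pow two_ne_zero
  have iB : Integrable (fun x => angularSum g x ^ 2) := (memLp_angularSum g).integrable_sq
  refine ⟨iA, ?_⟩
  have hF := polarField_hasTemperateGrowth hε hω
  have hibp (k : Fin 4) := integral_by_parts_temperate (hF k) g (EuclideanSpace.single k 1)
  have iF (k : Fin 4) : Integrable (fun x => 2 * (polarField ε ω k x *
      ⟪g x, fderiv ℝ g x (EuclideanSpace.single k 1)⟫_ℝ)) :=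
    (integrable_temperate_mul_inner (hF k) g
      (∂_{(EuclideanSpace.single k 1 : Sp)} g)).const_mul 2
  have h1 : ∫ x, ∑ k, 2 * (polarField ε ω k x *
      ⟪g x, fderiv ℝ g x (EuclideanSpace.single k 1)⟫_ℝ) =
      -∫ x, ∑ k, fderiv ℝ (polarField ε ω k) x (EuclideanSpace.single k 1) * ‖g x‖ ^ 2 := by
    rw [integral_finsetSum _ fun k _ => iF k, integral_finsetSum _ fun k _ => (hibp k).1,
      ← Finset.sum_neg_distrib]
    exact Finset.sum_congr rfl fun k _ => (hibp k).2
  have h2 : ∫ x, ∑ k, fderiv ℝ (polarField ε ω k) x (EuclideanSpace.single k 1) * ‖g x‖ ^ 2 ≤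
      ∫ x, (‖g x‖ ^ 2 - axial ω x ^ 2 * (regDist ε ω x)⁻¹ * ‖g x‖ ^ 2) := by
    refine integral_mono (integrable_finsetSum _ fun k _ => (hibp k).1) (iG.sub iA) fun x => ?_
    have := mul_le_mul_of_nonneg_right (divergence_polarField_le hε hω x) (sq_nonneg ‖g x‖)
    simp only [← Finset.sum_mul]
    linarith
  have h3 : ∫ x, ∑ k, 2 * (polarField ε ω k x *
      ⟪g x, fderiv ℝ g x (EuclideanSpace.single k 1)⟫_ℝ) ≤
      ∫ x, (1 / 2 * (axial ω x ^ 2 * (regDist ε ω x)⁻¹ * ‖g x‖ ^ 2) + 4 * angularSum g x ^ 2) := by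
    refine integral_mono (integrable_finsetSum _ fun k _ => iF k)
      ((iA.const_mul _).add (iB.const_mul _)) fun x => ?_
    simp only [← Finset.mul_sum]
    exact two_mul_inner_polarField_le hε hω g x
  rw [integral_sub iG iA] at h2
  rw [integral_add (iA.const_mul _) (iB.const_mul _), integral_const_mul, integral_const_mul] at h3
  linarith

/-- The sector of aperture `η` about `ω`. -/
def sector (ω : Sp) (η : ℝ) : Set Sp := {ξ | ξ ≠ 0 ∧ InnerProductGeometry.angle ξ ω ≤ η}

lemma measurableSet_sector (ω : Sp) (η : ℝ) : MeasurableSet (sector ω η) := by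
  have h : Measurable fun ξ : Sp => InnerProductGeometry.angle ξ ω := by
    unfold InnerProductGeometry.angle
    fun_prop
  exact (measurableSet_singleton (0 : Sp)).compl.inter (h measurableSet_Iic)

lemma norm_sq_sub_axial_sq_le {ω : Sp} (hω : ‖ω‖ = 1) {η : ℝ} {x : Sp} (hx : x ∈ sector ω η) :
    ‖x‖ ^ 2 - axial ω x ^ 2 ≤ η ^ 2 * ‖x‖ ^ 2 := by
  have h := InnerProductGeometry.cos_angle_mul_norm_mul_norm x ω
  rw [hω, mul_one, real_inner_comm] at h
  have h0 := InnerProductGeometry.angle_nonneg x ω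
  have h1 : Real.sin (InnerProductGeometry.angle x ω) ^ 2 ≤ η ^ 2 := by
    rw [sq_le_sq]
    calc _ ≤ |InnerProductGeometry.angle x ω| := Real.abs_sin_le_abs
      _ ≤ |η| := abs_le_abs_of_nonneg h0 hx.2
  calc ‖x‖ ^ 2 - axial ω x ^ 2 = Real.sin (InnerProductGeometry.angle x ω) ^ 2 * ‖x‖ ^ 2 := by
        rw [Real.sin_sq, axial, ← h]; ring
    _ ≤ _ := by gcongr

lemma setIntegral_sector_regularized_le {ε : ℝ} (hε : 0 < ε) {ω : Sp} (hω : ‖ω‖ = 1)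
    (g : SchwartzMap Sp ℂ) (η : ℝ) :
    ∫ x in sector ω η, ‖x‖ ^ 2 / (η ^ 2 * ‖x‖ ^ 2 + ε) * ‖g x‖ ^ 2 ≤
      3 * (∫ x, ‖g x‖ ^ 2) + 8 * ∫ x, angularSum g x ^ 2 := by
  obtain ⟨iA, hA⟩ := integral_axial_sq_le hε hω g
  have iG : Integrable (fun x => ‖g x‖ ^ 2) := (g.memLp 2).integrable_norm_pow two_ne_zero
  have hpt (x : Sp) (hx : x ∈ sector ω η) : ‖x‖ ^ 2 / (η ^ 2 * ‖x‖ ^ 2 + ε) * ‖g x‖ ^ 2 ≤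
      axial ω x ^ 2 * (regDist ε ω x)⁻¹ * ‖g x‖ ^ 2 + ‖g x‖ ^ 2 := by
    have hD := regDist_pos hε hω x
    rw [← add_one_mul]
    gcongr
    calc ‖x‖ ^ 2 / (η ^ 2 * ‖x‖ ^ 2 + ε) ≤ ‖x‖ ^ 2 / regDist ε ω x := by
          gcongr
          have := norm_sq_sub_axial_sq_le hω hx
          unfold regDist
          linarith
      _ ≤ axial ω x ^ 2 * (regDist ε ω x)⁻¹ + 1 := by
          field_simp
          unfold regDist
          linarith
  calc _ ≤ ∫ x in sector ω η, (axial ω x ^ 2 * (regDist ε ω x)⁻¹ * ‖g x‖ ^ 2 + ‖g x‖ ^ 2) := by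
        refine integral_mono_of_nonneg (ae_of_all _ fun x => by positivity)
          (iA.add iG).integrableOn ?_
        filter_upwards [ae_restrict_mem (measurableSet_sector ω η)] with x hx using hpt x hx
    _ ≤ ∫ x, (axial ω x ^ 2 * (regDist ε ω x)⁻¹ * ‖g x‖ ^ 2 + ‖g x‖ ^ 2) := by
        refine setIntegral_le_integral (iA.add iG) (ae_of_all _ fun x => ?_)
        have := regDist_pos hε hω x
        simp only [Pi.zero_apply]
        positivity
    _ ≤ _ := by rw [integral_add iA iG]; linarith

lemma setIntegral_sector_le {ω : Sp} (hω : ‖ω‖ = 1) (g : SchwartzMap Sp ℂ) {η : ℝ} (hη : 0 < η) :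
    ∫ x in sector ω η, ‖g x‖ ^ 2 ≤
      η ^ 2 * (3 * (∫ x, ‖g x‖ ^ 2) + 8 * ∫ x, angularSum g x ^ 2) := by
  have iG : Integrable (fun x => ‖g x‖ ^ 2) := (g.memLp 2).integrable_norm_pow two_ne_zero
  have hlim : Filter.Tendsto (fun n : ℕ => ∫ x in sector ω η,
      ‖x‖ ^ 2 / (η ^ 2 * ‖x‖ ^ 2 + 1 / ((n : ℝ) + 1)) * ‖g x‖ ^ 2) Filter.atTop
      (nhds (∫ x in sector ω η, (η ^ 2)⁻¹ * ‖g x‖ ^ 2)) := by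
    refine tendsto_integral_of_dominated_convergence (fun x => (η ^ 2)⁻¹ * ‖g x‖ ^ 2)
      (fun n => ?_) (iG.const_mul _).integrableOn (fun n => ae_of_all _ fun x => ?_) ?_
    · have := g.continuous.measurable
      exact Measurable.aestronglyMeasurable (by fun_prop)
    · rw [Real.norm_of_nonneg (by positivity)]
      gcongr
      rw [div_le_iff₀ (by positivity), mul_add, inv_mul_cancel_left₀ (by positivity)]
      exact le_add_of_nonneg_right (by positivity)
    · filter_upwards [ae_restrict_mem (measurableSet_sector ω η)] with x hx
      have hx0 : 0 < ‖x‖ := norm_pos_iff.2 hx.1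
      refine Filter.Tendsto.mul_const _ ?_
      have h0 : (η ^ 2)⁻¹ = ‖x‖ ^ 2 / (η ^ 2 * ‖x‖ ^ 2 + 0) := by
        field_simp
        simp
      rw [h0]
      exact tendsto_const_nhds.div (tendsto_one_div_add_atTop_nhds_zero_nat.const_add _)
        (by positivity)
  have h := le_of_tendsto' hlim fun n =>
    setIntegral_sector_regularized_le (ε := 1 / ((n : ℝ) + 1)) (by positivity) hω g η
  rw [integral_const_mul] at h
  rwa [inv_mul_le_iff₀ (by positivity)] at h

lemma eLpNorm_two_eq_ofReal_sqrt {α E : Type*} [MeasurableSpace α] {μ : Measure α}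
    [NormedAddCommGroup E] {f : α → E} (hf : MemLp f 2 μ) :
    eLpNorm f 2 μ = ENNReal.ofReal √(∫ x, ‖f x‖ ^ 2 ∂μ) := by
  rw [hf.eLpNorm_eq_integral_rpow_norm two_ne_zero ENNReal.ofNat_ne_top, Real.sqrt_eq_rpow]
  simp

lemma eLpNorm_angularSum_le (g : SchwartzMap Sp ℂ) :
    eLpNorm (angularSum g) 2 volume ≤
      ∑ i : Fin 4, ∑ j : Fin 4, if i < j then eLpNorm (Omega i j g) 2 volume else 0 := by
  have h := eLpNorm_sum_le (μ := volume) (p := 2)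
    (s := Finset.univ.filter fun p : Fin 4 × Fin 4 => p.1 < p.2)
    (f := fun (p : Fin 4 × Fin 4) (x : Sp) => ‖Omega p.1 p.2 g x‖)
    (fun p _ => (memLp_Omega g p.1 p.2).norm.aestronglyMeasurable) one_le_two
  have he : (∑ p : Fin 4 × Fin 4 with p.1 < p.2, fun x => ‖Omega p.1 p.2 g x‖) =
      angularSum g := by
    funext x
    simp [angularSum]
  rw [he] at h
  simpa only [eLpNorm_norm, Finset.sum_filter, Fintype.sum_prod_type] using h

/-- (Angular concentration estimate.)  There is an absolute constant `C`
such that for every Schwartz `g : ℝ⁴ → ℂ`, every unit vector `ω`, and every `η ∈ (0,1]`,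
the mass of `g` on the angular sector of aperture `η` about `ω` obeys
`(∫_{{ξ≠0 : ∠(ξ,ω)≤η}} |g|²)^{1/2} ≤ C η (‖g‖_{L²} + Σ_{i<j} ‖Ω_{ij}g‖_{L²})`. -/
theorem statement12 :
    ∃ C : ℝ, 0 < C ∧ ∀ g : SchwartzMap Sp ℂ, ∀ ω : Sp, ‖ω‖ = 1 →
      ∀ η : ℝ, 0 < η → η ≤ 1 →
        (∫⁻ ξ in {ξ : Sp | ξ ≠ 0 ∧ InnerProductGeometry.angle ξ ω ≤ η},
            (‖g ξ‖₊ : ℝ≥0∞) ^ (2:ℝ)) ^ (1/2 : ℝ) ≤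
          ENNReal.ofReal (C * η) *
            (eLpNorm (⇑g) 2 volume +
              ∑ i : Fin 4, ∑ j : Fin 4,
                if i < j then eLpNorm (Omega i j (⇑g)) 2 volume else 0) := by
  refine ⟨3, by norm_num, fun g ω hω η hη _ => ?_⟩
  have hL : (∫⁻ ξ in sector ω η, (‖g ξ‖₊ : ℝ≥0∞) ^ (2 : ℝ)) ^ (1 / 2 : ℝ) =
      ENNReal.ofReal √(∫ x in sector ω η, ‖g x‖ ^ 2) := by
    rw [← eLpNorm_two_eq_ofReal_sqrt ((g.memLp 2 volume).restrict _),
      eLpNorm_eq_lintegral_rpow_enorm_toReal two_ne_zero ENNReal.ofNat_ne_top]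
    simp [enorm_eq_nnnorm]
  have hB := eLpNorm_two_eq_ofReal_sqrt (memLp_angularSum g)
  simp only [Real.norm_eq_abs, sq_abs] at hB
  refine hL.trans_le (le_trans ?_ (mul_le_mul_right
    (add_le_add_right (eLpNorm_angularSum_le g) _) _))
  rw [eLpNorm_two_eq_ofReal_sqrt (g.memLp 2 volume), hB,
    ← ENNReal.ofReal_add (Real.sqrt_nonneg _) (Real.sqrt_nonneg _),
    ← ENNReal.ofReal_mul (by positivity)]
  refine ENNReal.ofReal_le_ofReal (Real.sqrt_le_iff.2 ⟨by positivity, ?_⟩)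
  refine (setIntegral_sector_le hω g hη).trans ?_
  have hG0 : 0 ≤ ∫ x, ‖g x‖ ^ 2 := integral_nonneg fun x => by positivity
  have hB0 : 0 ≤ ∫ x, angularSum g x ^ 2 := integral_nonneg fun x => sq_nonneg _
  have h1 := Real.sq_sqrt hG0
  have h2 := Real.sq_sqrt hB0
  rw [mul_pow, mul_pow, mul_comm (3 ^ 2), mul_assoc]
  gcongr
  nlinarith [mul_nonneg (Real.sqrt_nonneg (∫ x, ‖g x‖ ^ 2))
    (Real.sqrt_nonneg (∫ x, angularSum g x ^ 2))]

end
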